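/- Elliptic hypergeometric transformation (Langer–Schlosser–Warnaar identity): for all m, k ∈ ℤ_{≥0} and all x, z ∈ ℂ^m at which all bracket values occurring in denominators on either side are nonzero, Σ_{μ ∈ ℤ_{≥0}^m, |μ| = k} ∏_{i,j=1}^m ( [x_i−x_j+δ]_{μ_i−μ_j}/[x_i−x_j+κ; δ]_{μ_i−μ_j} · ([x_i−x_j+κ; δ]_{μ_i} [x_i+z_j]_{μ_i})/([x_i−x_j+δ]_{μ_i} [x_i+z_j+δ−κ]_{μ_i}) ) = Σ_{μ ∈ ℤ_{≥0}^m, |μ| = k} ∏_{i,j=1}^m ( [z_i−z_j+δ]_{μ_i−μ_j}/[z_i−z_j+κ; δ]_{μ_i−μ_j} · ([z_i−z_j+κ; δ]_{μ_i} [z_i+x_j]_{μ_i})/([z_i−z_j+δ]_{μ_i} [z_i+x_j+δ−κ]_{μ_i}) ). -/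

import Mathlib

open Finset

/-- Shifted factorial `[x; a]_k` for `k ∈ ℤ`:
`[x; a]_k = [x][x+a]⋯[x+(k-1)a]` for `k ≥ 0` and `[x; a]_{-k} = 1/[x-ka; a]_k`. -/
noncomputable def sfac (br : ℂ → ℂ) (a x : ℂ) (k : ℤ) : ℂ :=
  if 0 ≤ k then ∏ i ∈ Finset.range k.toNat, br (x + (i : ℂ) * a)
  else (∏ i ∈ Finset.range (-k).toNat, br (x + ((k : ℂ) + (i : ℂ)) * a))⁻¹

/-- The summand of the Langer–Schlosser–Warnaar sum. -/
noncomputable def LSWterm (br : ℂ → ℂ) (δ κ : ℂ) {m : ℕ} (μ : Fin m → ℕ)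
    (x z : Fin m → ℂ) : ℂ :=
  ∏ i : Fin m, ∏ j : Fin m,
    (sfac br δ (x i - x j + δ) ((μ i : ℤ) - (μ j : ℤ))
        / sfac br δ (x i - x j + κ) ((μ i : ℤ) - (μ j : ℤ)))
      * ((sfac br δ (x i - x j + κ) (μ i : ℤ) * sfac br δ (x i + z j) (μ i : ℤ))
          / (sfac br δ (x i - x j + δ) (μ i : ℤ)
            * sfac br δ (x i + z j + δ - κ) (μ i : ℤ)))

/-- Index set: `μ ∈ ℤ_{≥0}^m` with `|μ| = k`. -/
def muSet (m k : ℕ) : Finset (Fin m → ℕ) :=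
  (Fintype.piFinset fun _ : Fin m => Finset.range (k + 1)).filter
    fun μ => (∑ i, μ i) = k

/-- Nonvanishing of all bracket values occurring in denominators of a term. -/
def LSWDenomNZ (br : ℂ → ℂ) (δ κ : ℂ) {m : ℕ} (μ : Fin m → ℕ)
    (x z : Fin m → ℂ) : Prop :=
  ∀ i j : Fin m,
    (if (0 : ℤ) ≤ (μ i : ℤ) - (μ j : ℤ) then
        sfac br δ (x i - x j + κ) ((μ i : ℤ) - (μ j : ℤ)) ≠ 0
      else sfac br δ (x i - x j + δ) ((μ i : ℤ) - (μ j : ℤ)) ≠ 0)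
      ∧ sfac br δ (x i - x j + δ) (μ i : ℤ) ≠ 0
      ∧ sfac br δ (x i + z j + δ - κ) (μ i : ℤ) ≠ 0

/-- A bracket: an odd entire function, not identically zero, satisfying the three-term
(Weierstrass) relation. -/
structure IsBracket (br : ℂ → ℂ) : Prop where
  odd : ∀ z : ℂ, br (-z) = -br z
  differentiable : Differentiable ℂ br
  ne_zero : br ≠ 0
  weierstrass : ∀ a b c d : ℂ,
      br (a + b) * br (a - b) * br (c + d) * br (c - d)
        + br (a + d) * br (a - d) * br (b + c) * br (b - c)
        = br (a + c) * br (a - c) * br (b + d) * br (b - d)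

namespace IsBracket

variable {br : ℂ → ℂ}

theorem map_zero (h : IsBracket br) : br 0 = 0 := by
  have h0 := h.odd 0
  rw [neg_zero] at h0
  exact self_eq_neg.mp h0

theorem sub_comm (h : IsBracket br) (a b : ℂ) : br (a - b) = -br (b - a) := by
  rw [← h.odd, neg_sub]

theorem continuous (h : IsBracket br) : Continuous br := h.differentiable.continuous

theorem eventually_ne (h : IsBracket br) (z : ℂ) : ∀ᶠ t in nhdsWithin z {z}ᶜ, br t ≠ 0 := by
  have han : AnalyticOnNhd ℂ br Set.univ := fun w _ => h.differentiable.analyticAt w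
  rcases (h.differentiable.analyticAt z).eventually_eq_zero_or_eventually_ne_zero with h0 | h0
  · exact absurd (funext fun w => han.eqOn_zero_of_preconnected_of_eventuallyEq_zero
      isPreconnected_univ (Set.mem_univ z) h0 (Set.mem_univ w)) h.ne_zero
  · exact h0

theorem eventually_add_ne (h : IsBracket br) (a : ℂ) :
    ∀ᶠ t in nhdsWithin (0 : ℂ) {0}ᶜ, br (a + t) ≠ 0 := by
  have ht : Filter.Tendsto (fun t : ℂ => a + t) (nhdsWithin 0 {0}ᶜ) (nhdsWithin a {a}ᶜ) := by
    refine tendsto_nhdsWithin_iff.mpr ⟨?_, ?_⟩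
    · have : Filter.Tendsto (fun t : ℂ => a + t) (nhds 0) (nhds (a + 0)) :=
        (continuous_const.add continuous_id).tendsto 0
      rw [add_zero] at this
      exact this.mono_left nhdsWithin_le_nhds
    · filter_upwards [self_mem_nhdsWithin] with t ht
      simpa using ht
  exact ht.eventually (h.eventually_ne a)

/-- The zero of a bracket at the origin is simple. -/
theorem exists_tendsto_div (h : IsBracket br) :
    ∃ g₀ : ℂ, g₀ ≠ 0 ∧
      Filter.Tendsto (fun t => br t / t) (nhdsWithin 0 {0}ᶜ) (nhds g₀) := by
  have han := h.differentiable.analyticAt 0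
  have hne : ¬ ∀ᶠ z in nhds (0 : ℂ), br z = 0 := by
    intro h0
    obtain ⟨t, ht, ht'⟩ := ((h.eventually_ne 0).and (h0.filter_mono nhdsWithin_le_nhds)).exists
    exact ht ht'
  obtain ⟨n, g, hg, hg0, hfg⟩ := han.exists_eventuallyEq_pow_smul_nonzero_iff.mpr hne
  simp only [sub_zero, smul_eq_mul] at hfg
  have hscale : ∀ a : ℂ, Filter.Tendsto (fun t : ℂ => t * a) (nhdsWithin 0 {0}ᶜ) (nhds 0) := by
    intro a
    have : Filter.Tendsto (fun t : ℂ => t * a) (nhds 0) (nhds (0 * a)) :=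
      (continuous_id.mul continuous_const).tendsto 0
    rw [zero_mul] at this
    exact this.mono_left nhdsWithin_le_nhds
  have hlim : ∀ a : ℂ, Filter.Tendsto (fun t => br (t * a) / t ^ n) (nhdsWithin 0 {0}ᶜ)
      (nhds (a ^ n * g 0)) := by
    intro a
    have h1 : Filter.Tendsto (fun t => a ^ n * g (t * a)) (nhdsWithin 0 {0}ᶜ)
        (nhds (a ^ n * g 0)) :=
      (hg.continuousAt.tendsto.comp (hscale a)).const_mul _
    refine h1.congr' ?_
    filter_upwards [(hscale a).eventually hfg, self_mem_nhdsWithin] with t ht ht0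
    have : t ≠ 0 := ht0
    rw [ht, mul_pow]
    field_simp
  have hn : (5 : ℂ) ^ n + 27 ^ n = 32 ^ n := by
    have hl := (((hlim 5).mul (hlim 1)).mul ((hlim 1).mul (hlim 1))).add
      (((hlim 3).mul (hlim 3)).mul ((hlim 3).mul (hlim 1)))
    have hr := ((hlim 4).mul (hlim 2)).mul ((hlim 2).mul (hlim 2))
    have heq := tendsto_nhds_unique (hl.congr' (Filter.Eventually.of_forall fun t => by
      have := h.weierstrass (t * 3) (t * 2) (t * 1) (t * 0)
      ring_nf at this ⊢
      linear_combination (t ^ n)⁻¹ ^ 4 * this)) hr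
    have hg4 : (g 0) ^ 4 ≠ 0 := pow_ne_zero _ hg0
    apply mul_right_cancel₀ hg4
    have e5 : (5 : ℂ) ^ n * 1 ^ n * (1 ^ n * 1 ^ n) = 5 ^ n := by simp
    have e27 : (3 : ℂ) ^ n * 3 ^ n * (3 ^ n * 1 ^ n) = 27 ^ n := by
      simp only [← mul_pow]; norm_num
    have e32 : (4 : ℂ) ^ n * 2 ^ n * (2 ^ n * 2 ^ n) = 32 ^ n := by
      simp only [← mul_pow]; norm_num
    rw [← e5, ← e27, ← e32]
    linear_combination heq
  have hnat : 5 ^ n + 27 ^ n = 32 ^ n := by exact_mod_cast hn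
  have hn1 : n = 1 := by
    rcases n with _ | _ | n
    · simp at hnat
    · rfl
    · exfalso
      have h5 : 5 ^ (n + 1) ≤ 32 ^ (n + 1) := Nat.pow_le_pow_left (by norm_num) _
      have h27 : 27 ^ (n + 1) < 32 ^ (n + 1) := Nat.pow_lt_pow_left (by norm_num) (by simp)
      rw [pow_succ 5, pow_succ 27, pow_succ 32] at hnat
      omega
  subst hn1
  exact ⟨g 0, hg0, by simpa using hlim 1⟩

end IsBracket

/-- The kernel `[u + l] / ([l][u])`. -/
noncomputable def kronecker (br : ℂ → ℂ) (l u : ℂ) : ℂ := br (u + l) / (br l * br u)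

theorem Matrix.det_eq_of_schur {n : ℕ} (A : Matrix (Fin (n + 1)) (Fin (n + 1)) ℂ)
    (M : Matrix (Fin n) (Fin n) ℂ) (α β : Fin n → ℂ) (hA : A 0 0 ≠ 0)
    (hM : ∀ i j, A i.succ j.succ - A i.succ 0 * A 0 j.succ / A 0 0 = α i * β j * M i j) :
    A.det = A 0 0 * ((∏ i, α i) * (∏ j, β j) * M.det) := by
  let c : Fin (n + 1) → ℂ := Fin.cons 0 fun i => A i.succ 0 / A 0 0
  let B : Matrix (Fin (n + 1)) (Fin (n + 1)) ℂ := Matrix.of fun i j => A i j - c i * A 0 j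
  have hdet : A.det = B.det := by
    refine Matrix.det_eq_of_forall_row_eq_smul_add_const c 0 rfl fun i j => ?_
    simp [B, c]
  have hsub : B.submatrix Fin.succ Fin.succ
      = Matrix.of fun i j => α i * (Matrix.of fun i j => β j * M i j) i j := by
    ext i j
    have := hM i j
    simp only [B, c, Matrix.submatrix_apply, Matrix.of_apply, Fin.cons_succ]
    linear_combination this
  rw [hdet, Matrix.det_succ_column_zero, Fin.sum_univ_succ, Finset.sum_eq_zero]
  · have h00 : B 0 0 = A 0 0 := by simp [B, c]
    have : (0 : Fin (n + 1)).succAbove = Fin.succ := by ext; simp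
    rw [this, hsub, Matrix.det_mul_column, Matrix.det_mul_row, h00]
    simp [mul_assoc]
  · intro i _
    have : B i.succ 0 = 0 := by
      simp only [B, c, Matrix.of_apply, Fin.cons_succ]
      field_simp
      simp
    rw [this]
    simp

namespace IsBracket

variable {br : ℂ → ℂ}

theorem kronecker_schur (h : IsBracket br) (l x₀ y₀ x y : ℂ) (hl : br l ≠ 0)
    (hl' : br (l + (x₀ + y₀)) ≠ 0) (h10 : br (x + y₀) ≠ 0)
    (h01 : br (x₀ + y) ≠ 0) (h11 : br (x + y) ≠ 0) :
    kronecker br l (x + y) - kronecker br l (x + y₀) * kronecker br l (x₀ + y)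
        / kronecker br l (x₀ + y₀)
      = br (x - x₀) / br (x + y₀) * (br (y - y₀) / br (x₀ + y))
        * kronecker br (l + (x₀ + y₀)) (x + y) := by
  have hW := h.weierstrass (x + y₀ + (y - y₀ + l) / 2) (x₀ + y₀ + (y - y₀ + l) / 2)
    ((y - y₀ + l) / 2) ((y - y₀ - l) / 2)
  have e1 : x + y₀ + (y - y₀ + l) / 2 + (x₀ + y₀ + (y - y₀ + l) / 2)
    = x + y + (l + (x₀ + y₀)) := by ring
  have e2 : x + y₀ + (y - y₀ + l) / 2 - (x₀ + y₀ + (y - y₀ + l) / 2) = x - x₀ := by ring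
  have e3 : (y - y₀ + l) / 2 + (y - y₀ - l) / 2 = y - y₀ := by ring
  have e4 : (y - y₀ + l) / 2 - (y - y₀ - l) / 2 = l := by ring
  have e5 : x + y₀ + (y - y₀ + l) / 2 + (y - y₀ - l) / 2 = x + y := by ring
  have e6 : x + y₀ + (y - y₀ + l) / 2 - (y - y₀ - l) / 2 = x + y₀ + l := by ring
  have e7 : x₀ + y₀ + (y - y₀ + l) / 2 + (y - y₀ + l) / 2 = x₀ + y + l := by ring
  have e8 : x₀ + y₀ + (y - y₀ + l) / 2 - (y - y₀ + l) / 2 = x₀ + y₀ := by ring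
  have e9 : x + y₀ + (y - y₀ + l) / 2 + (y - y₀ + l) / 2 = x + y + l := by ring
  have e10 : x + y₀ + (y - y₀ + l) / 2 - (y - y₀ + l) / 2 = x + y₀ := by ring
  have e11 : x₀ + y₀ + (y - y₀ + l) / 2 + (y - y₀ - l) / 2 = x₀ + y := by ring
  have e12 : x₀ + y₀ + (y - y₀ + l) / 2 - (y - y₀ - l) / 2 = l + (x₀ + y₀) := by ring
  rw [e1, e2, e3, e4, e5, e6, e7, e8, e9, e10, e11, e12] at hW
  have hl'' : br (x₀ + y₀ + l) ≠ 0 := by rwa [add_comm]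
  unfold kronecker
  rw [add_comm (x₀ + y₀) l]
  field_simp
  linear_combination -hW

/-- The Cauchy-type product appearing in the Frobenius determinant. -/
noncomputable def _root_.cauchyProd (br : ℂ → ℂ) {n : ℕ} (x y : Fin n → ℂ) : ℂ :=
  (∏ i, ∏ j ∈ Ioi i, br (x j - x i)) * (∏ i, ∏ j ∈ Ioi i, br (y j - y i))
    / ∏ i, ∏ j, br (x i + y j)

theorem _root_.cauchyProd_comm (br : ℂ → ℂ) {n : ℕ} (x y : Fin n → ℂ) :
    cauchyProd br x y = cauchyProd br y x := by
  unfold cauchyProd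
  rw [mul_comm, Finset.prod_comm]
  simp only [add_comm]

/-- The Frobenius determinant evaluation, for generic spectral parameter `l`. -/
theorem det_kronecker (h : IsBracket br) {n : ℕ} (l : ℂ) (x y : Fin n → ℂ)
    (hxy : ∀ i j, br (x i + y j) ≠ 0)
    (hl : ∀ A : Finset (Fin n), br (l + ∑ i ∈ A, (x i + y i)) ≠ 0) :
    (Matrix.of fun i j => kronecker br l (x i + y j)).det
      = cauchyProd br x y * (br (l + ∑ i, (x i + y i)) / br l) := by
  induction n generalizing l with
  | zero =>
    have := hl ∅
    simp at this
    simp [cauchyProd, this]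
  | succ n ih =>
    have hl0 : br l ≠ 0 := by simpa using hl ∅
    have hl1 : br (l + (x 0 + y 0)) ≠ 0 := by simpa using hl {0}
    have hk0 : kronecker br l (x 0 + y 0) ≠ 0 := by
      unfold kronecker
      rw [add_comm (x 0 + y 0)]
      exact div_ne_zero hl1 (mul_ne_zero hl0 (hxy 0 0))
    rw [Matrix.det_eq_of_schur _
      (Matrix.of fun i j : Fin n => kronecker br (l + (x 0 + y 0)) (x i.succ + y j.succ))
      (fun i => br (x i.succ - x 0) / br (x i.succ + y 0))
      (fun j => br (y j.succ - y 0) / br (x 0 + y j.succ)) hk0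
      (fun i j => h.kronecker_schur l (x 0) (y 0) (x i.succ) (y j.succ) hl0 hl1
        (hxy _ _) (hxy _ _) (hxy _ _)),
      ih (l + (x 0 + y 0)) (fun i => x i.succ) (fun i => y i.succ) (fun i j => hxy _ _)]
    · simp only [Matrix.of_apply, cauchyProd, kronecker, Fin.prod_univ_succ, Fin.sum_univ_succ,
        Fin.prod_Ioi_zero, Fin.prod_Ioi_succ, Finset.prod_div_distrib, Finset.prod_mul_distrib]
      rw [add_comm (x 0 + y 0) l, add_assoc l]
      have h00 := hxy 0 0
      have hr : ∏ j : Fin n, br (x 0 + y j.succ) ≠ 0 := Finset.prod_ne_zero_iff.mpr fun j _ => hxy _ _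
      have hc : ∏ i : Fin n, br (x i.succ + y 0) ≠ 0 := Finset.prod_ne_zero_iff.mpr fun j _ => hxy _ _
      have hb : ∏ i : Fin n, ∏ j : Fin n, br (x i.succ + y j.succ) ≠ 0 :=
        Finset.prod_ne_zero_iff.mpr fun i _ => Finset.prod_ne_zero_iff.mpr fun j _ => hxy _ _
      field_simp
    · intro A
      have := hl (insert 0 (A.map (Fin.succEmb n)))
      rw [Finset.sum_insert (by simp), Finset.sum_map, ← add_assoc] at this
      simpa using this

end IsBracket

/-- The vector `x` with `c` added to the coordinates in `I`. -/
noncomputable def shiftOn {m : ℕ} (c : ℂ) (I : Finset (Fin m)) (x : Fin m → ℂ) : Fin m → ℂ :=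
  fun i => x i + if i ∈ I then c else 0

/-- The coefficient `∏ [x_i - x_j + c] / [x_i - x_j]`, over `i ∈ I` and `j ∉ I`, of the Ruijsenaars
operators. -/
noncomputable def dcoef (br : ℂ → ℂ) (c : ℂ) {m : ℕ} (I : Finset (Fin m)) (x : Fin m → ℂ) : ℂ :=
  ∏ i ∈ I, ∏ j ∈ Iᶜ, br (x i - x j + c) / br (x i - x j)

/-- The product `∏ [x_i + y_k] / [x_i + y_k + c]` over `i ∈ I` and all `k`. -/
noncomputable def dker (br : ℂ → ℂ) (c : ℂ) {m : ℕ} (I : Finset (Fin m)) (x y : Fin m → ℂ) : ℂ :=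
  ∏ i ∈ I, ∏ k, br (x i + y k) / br (x i + y k + c)

theorem sum_shiftOn {m : ℕ} (c : ℂ) (I : Finset (Fin m)) (x y : Fin m → ℂ) :
    ∑ i, (shiftOn c I x i + y i) = ∑ i, (x i + y i) + (#I : ℂ) * c := by
  simp only [shiftOn, Finset.sum_add_distrib, Finset.sum_ite_mem, Finset.univ_inter,
    Finset.sum_const, nsmul_eq_mul]
  ring

namespace IsBracket

variable {br : ℂ → ℂ}

theorem vandermonde_shiftOn (h : IsBracket br) (c : ℂ) {m : ℕ} (I : Finset (Fin m))
    (x : Fin m → ℂ) (hx : ∀ i j, i ≠ j → br (x i - x j) ≠ 0) :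
    ∏ i, ∏ j ∈ Ioi i, br (shiftOn c I x j - shiftOn c I x i)
      = (∏ i, ∏ j ∈ Ioi i, br (x j - x i)) * dcoef br c I x := by
  let s : Fin m → Fin m → ℂ := fun i j =>
    if i ∈ I ∧ j ∈ Iᶜ then br (x i - x j + c) / br (x i - x j) else 1
  have hs : dcoef br c I x = ∏ i, ∏ j ∈ Ioi i, s j i * s i j := by
    rw [Finset.prod_prod_Ioi_mul_eq_prod_prod_off_diag, dcoef]
    have h1 : ∀ i, ∏ j ∈ {i}ᶜ, s j i = ∏ j, s j i := fun i => by
      refine Finset.prod_subset (Finset.subset_univ _) fun j _ hj => ?_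
      have : j = i := by simpa using hj
      simp [s, this]
    simp only [h1]
    rw [Finset.prod_comm]
    simp only [s, ite_and, Finset.prod_ite_irrel, Finset.prod_const_one, Finset.prod_ite_mem,
      Finset.univ_inter]
  rw [hs, ← Finset.prod_mul_distrib]
  refine Finset.prod_congr rfl fun i _ => ?_
  rw [← Finset.prod_mul_distrib]
  refine Finset.prod_congr rfl fun j hj => ?_
  have hij : i ≠ j := (Finset.mem_Ioi.mp hj).ne
  have h1 := hx i j hij
  have h2 := hx j i hij.symm
  by_cases hi : i ∈ I <;> by_cases hj : j ∈ I <;>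
    simp only [shiftOn, s, hi, hj, Finset.mem_compl, not_true, not_false_eq_true, and_true,
      and_false, if_true, if_false, mul_one, one_mul, add_zero, add_sub_add_right_eq_sub]
  · have e : x j - (x i + c) = -(x i - x j + c) := by ring
    rw [e, h.odd, h.sub_comm (x j)]
    field_simp
  · rw [add_sub_right_comm]
    field_simp

theorem cauchyProd_shiftOn (h : IsBracket br) (c : ℂ) {m : ℕ} (I : Finset (Fin m))
    (x y : Fin m → ℂ) (hx : ∀ i j, i ≠ j → br (x i - x j) ≠ 0)
    (hxy : ∀ i j, br (x i + y j) ≠ 0) :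
    cauchyProd br (shiftOn c I x) y = cauchyProd br x y * (dcoef br c I x * dker br c I x y) := by
  have hk : ∏ i, ∏ j, br (shiftOn c I x i + y j)
      = (∏ i, ∏ j, br (x i + y j)) * (dker br c I x y)⁻¹ := by
    have : (dker br c I x y)⁻¹
        = ∏ i, if i ∈ I then ∏ k, br (x i + y k + c) / br (x i + y k) else 1 := by
      rw [Finset.prod_ite_mem, Finset.univ_inter]
      simp [dker]
    rw [this, ← Finset.prod_mul_distrib]
    refine Finset.prod_congr rfl fun i _ => ?_
    by_cases hi : i ∈ I
    · simp only [hi, if_true, shiftOn, ← Finset.prod_mul_distrib]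
      refine Finset.prod_congr rfl fun j _ => ?_
      have := hxy i j
      rw [add_right_comm]
      field_simp
    · simp [hi, shiftOn]
  unfold cauchyProd
  rw [h.vandermonde_shiftOn c I x hx, hk, mul_comm (∏ i, ∏ j, br (x i + y j)), ← div_div,
    div_inv_eq_mul]
  ring

theorem det_kronecker_add_shift (h : IsBracket br) {m : ℕ} (l c w : ℂ) (x y : Fin m → ℂ)
    (hx : ∀ i j, i ≠ j → br (x i - x j) ≠ 0) (hxy : ∀ i j, br (x i + y j) ≠ 0)
    (hxyc : ∀ i j, br (x i + y j + c) ≠ 0)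
    (hl : ∀ I A : Finset (Fin m), br (l + ∑ i ∈ A, (shiftOn c I x i + y i)) ≠ 0) :
    (Matrix.of fun i j => w * kronecker br l (x i + y j + c) + kronecker br l (x i + y j)).det
      = cauchyProd br x y * ∑ I : Finset (Fin m), w ^ #I * (dcoef br c I x * dker br c I x y)
          * (br (l + (∑ i, (x i + y i) + (#I : ℂ) * c)) / br l) := by
  have key := (Matrix.detRowAlternating (n := Fin m) (R := ℂ)).toMultilinearMap.map_add_univ
    (fun i j => w * kronecker br l (x i + y j + c)) (fun i j => kronecker br l (x i + y j))
  refine key.trans ?_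
  rw [Finset.mul_sum]
  refine Finset.sum_congr rfl fun I _ => ?_
  have hrow : I.piecewise (fun i j => w * kronecker br l (x i + y j + c))
      (fun i j => kronecker br l (x i + y j))
      = Matrix.of fun i j => (if i ∈ I then w else 1)
          * (Matrix.of fun i j => kronecker br l (shiftOn c I x i + y j)) i j := by
    ext i j
    by_cases hi : i ∈ I
    · simp [hi, shiftOn, add_right_comm]
    · simp [hi, shiftOn]
  have hI : ∀ i j, br (shiftOn c I x i + y j) ≠ 0 := fun i j => by
    by_cases hi : i ∈ I
    · simpa [hi, shiftOn, add_right_comm] using hxyc i j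
    · simpa [hi, shiftOn] using hxy i j
  have hdet := Matrix.det_mul_column (fun i => if i ∈ I then w else 1)
    (Matrix.of fun i j => kronecker br l (shiftOn c I x i + y j))
  rw [h.det_kronecker l _ y hI (hl I), h.cauchyProd_shiftOn c I x y hx hxy, sum_shiftOn,
    Finset.prod_ite_mem, Finset.univ_inter, Finset.prod_const] at hdet
  rw [hrow]
  refine hdet.trans ?_
  ring

theorem eventually_generic (h : IsBracket br) {m : ℕ} (c : ℂ) (x y : Fin m → ℂ) :
    ∀ᶠ l in nhdsWithin (0 : ℂ) {0}ᶜ, ∀ I A : Finset (Fin m),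
      br (l + ∑ i ∈ A, (shiftOn c I x i + y i)) ≠ 0 := by
  refine Filter.eventually_all.mpr fun I => Filter.eventually_all.mpr fun A => ?_
  simpa only [add_comm] using h.eventually_add_ne (∑ i ∈ A, (shiftOn c I x i + y i))

theorem cauchyProd_ne_zero {m : ℕ} (x y : Fin m → ℂ)
    (hx : ∀ i j, i ≠ j → br (x i - x j) ≠ 0) (hy : ∀ i j, i ≠ j → br (y i - y j) ≠ 0)
    (hxy : ∀ i j, br (x i + y j) ≠ 0) : cauchyProd br x y ≠ 0 := by
  have hV : ∀ v : Fin m → ℂ, (∀ i j, i ≠ j → br (v i - v j) ≠ 0) →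
      ∏ i, ∏ j ∈ Ioi i, br (v j - v i) ≠ 0 := fun v hv =>
    Finset.prod_ne_zero_iff.mpr fun i _ => Finset.prod_ne_zero_iff.mpr fun j hj =>
      hv j i (Finset.mem_Ioi.mp hj).ne'
  exact div_ne_zero (mul_ne_zero (hV x hx) (hV y hy))
    (Finset.prod_ne_zero_iff.mpr fun i _ => Finset.prod_ne_zero_iff.mpr fun j _ => hxy i j)

/-- The kernel identity for the Ruijsenaars operators, in balanced form. -/
theorem sum_dcoef_dker_comm (h : IsBracket br) {m : ℕ} (c : ℂ) (x y : Fin m → ℂ)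
    (hx : ∀ i j, i ≠ j → br (x i - x j) ≠ 0) (hy : ∀ i j, i ≠ j → br (y i - y j) ≠ 0)
    (hxy : ∀ i j, br (x i + y j) ≠ 0) (hxyc : ∀ i j, br (x i + y j + c) ≠ 0) (r : ℕ) :
    ∑ I ∈ powersetCard r univ, dcoef br c I x * dker br c I x y
      = ∑ I ∈ powersetCard r univ, dcoef br c I y * dker br c I y x := by
  obtain ⟨l, hl0, hlx, hly, hlr⟩ := ((h.eventually_ne 0).and ((h.eventually_generic c x y).and
    ((h.eventually_generic c y x).and
      (h.eventually_add_ne (∑ i, (x i + y i) + (r : ℂ) * c))))).exists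
  have hsum : ∑ i, (y i + x i) = ∑ i, (x i + y i) := by simp only [add_comm]
  let P : (Fin m → ℂ) → (Fin m → ℂ) → Polynomial ℂ := fun u v =>
    ∑ I : Finset (Fin m), Polynomial.monomial #I (dcoef br c I u * dker br c I u v
      * (br (l + (∑ i, (x i + y i) + (#I : ℂ) * c)) / br l))
  have hP : P x y = P y x := by
    refine Polynomial.funext fun w => ?_
    have hd1 := h.det_kronecker_add_shift l c w x y hx hxy hxyc hlx
    have hd2 := h.det_kronecker_add_shift l c w y x hy
      (fun i j => by rw [add_comm]; exact hxy j i)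
      (fun i j => by rw [add_comm (y i)]; exact hxyc j i) hly
    rw [← Matrix.det_transpose, hsum, ← cauchyProd_comm] at hd2
    have hmat : (Matrix.of fun i j => w * kronecker br l (y i + x j + c)
        + kronecker br l (y i + x j)).transpose
        = Matrix.of fun i j => w * kronecker br l (x i + y j + c) + kronecker br l (x i + y j) := by
      ext i j
      simp [add_comm (y j)]
    rw [hmat, hd1] at hd2
    have := mul_left_cancel₀ (cauchyProd_ne_zero x y hx hy hxy) hd2
    simp only [P, Polynomial.eval_finsetSum, Polynomial.eval_monomial]
    calc _ = _ := Finset.sum_congr rfl fun I _ => by ring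
      _ = _ := this
      _ = _ := Finset.sum_congr rfl fun I _ => by ring
  have hcoeff : ∀ u v : Fin m → ℂ, (P u v).coeff r
      = (∑ I ∈ powersetCard r univ, dcoef br c I u * dker br c I u v)
        * (br (l + (∑ i, (x i + y i) + (r : ℂ) * c)) / br l) := by
    intro u v
    simp only [P, Polynomial.finsetSum_coeff, Polynomial.coeff_monomial]
    rw [← Finset.sum_filter, Finset.sum_mul]
    have : (univ.filter fun I : Finset (Fin m) => #I = r) = powersetCard r univ := by
      ext I; simp [Finset.mem_powersetCard]
    rw [this]
    refine Finset.sum_congr rfl fun I hI => ?_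
    rw [(Finset.mem_powersetCard.mp hI).2]
  have hc := congrArg (fun p => p.coeff r) hP
  simp only [hcoeff] at hc
  refine mul_right_cancel₀ (div_ne_zero ?_ hl0) hc
  rwa [add_comm]

theorem exists_tendsto_kronecker_sub (h : IsBracket br) (u v : ℂ) (hu : br u ≠ 0)
    (hv : br v ≠ 0) : ∃ L : ℂ, Filter.Tendsto (fun l => -1 * kronecker br l v + kronecker br l u)
      (nhdsWithin 0 {0}ᶜ) (nhds L) := by
  obtain ⟨g, hg, hlim⟩ := h.exists_tendsto_div
  have hd : ∀ u : ℂ, Filter.Tendsto (fun l => l⁻¹ * (br (u + l) - br u)) (nhdsWithin 0 {0}ᶜ)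
      (nhds (deriv br u)) := fun u => by
    simpa using (h.differentiable u).hasDerivAt.tendsto_slope_zero
  refine ⟨_, Filter.Tendsto.congr' ?_
    ((((hd u).mul_const (br u)⁻¹).sub ((hd v).mul_const (br v)⁻¹)).div hlim hg)⟩
  filter_upwards [self_mem_nhdsWithin, h.eventually_ne 0] with l hl hl'
  have hl : l ≠ 0 := hl
  simp only [Pi.div_apply, kronecker]
  field_simp
  ring

theorem sum_alternating_of_ne_zero (h : IsBracket br) {m : ℕ} (c : ℂ) (x y : Fin m → ℂ)
    (hx : ∀ i j, i ≠ j → br (x i - x j) ≠ 0) (hy : ∀ i j, i ≠ j → br (y i - y j) ≠ 0)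
    (hxy : ∀ i j, br (x i + y j) ≠ 0) (hxyc : ∀ i j, br (x i + y j + c) ≠ 0) :
    ∑ I : Finset (Fin m), (-1) ^ #I * br (∑ i, (x i + y i) + (#I : ℂ) * c)
      * (dcoef br c I x * dker br c I x y) = 0 := by
  choose L hL using fun i j => h.exists_tendsto_kronecker_sub (x i + y j) (x i + y j + c)
    (hxy i j) (hxyc i j)
  have hM : Filter.Tendsto (fun l => Matrix.of fun i j =>
      -1 * kronecker br l (x i + y j + c) + kronecker br l (x i + y j))
      (nhdsWithin 0 {0}ᶜ) (nhds (Matrix.of L)) :=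
    tendsto_pi_nhds.mpr fun i => tendsto_pi_nhds.mpr fun j => hL i j
  have hdet := ((continuous_id.matrix_det.tendsto (Matrix.of L)).comp hM)
  have hbr : Filter.Tendsto br (nhdsWithin 0 {0}ᶜ) (nhds 0) := by
    have := h.continuous.tendsto 0
    rw [h.map_zero] at this
    exact this.mono_left nhdsWithin_le_nhds
  have h0 := (hbr.mul hdet).const_mul (cauchyProd br x y)⁻¹
  rw [zero_mul, mul_zero] at h0
  have h1 : Filter.Tendsto (fun l => ∑ I : Finset (Fin m),
      (-1) ^ #I * br (l + (∑ i, (x i + y i) + (#I : ℂ) * c))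
      * (dcoef br c I x * dker br c I x y)) (nhdsWithin 0 {0}ᶜ)
      (nhds (∑ I : Finset (Fin m), (-1) ^ #I * br (0 + (∑ i, (x i + y i) + (#I : ℂ) * c))
      * (dcoef br c I x * dker br c I x y))) := by
    have hc : Continuous fun l => ∑ I : Finset (Fin m),
        (-1) ^ #I * br (l + (∑ i, (x i + y i) + (#I : ℂ) * c))
        * (dcoef br c I x * dker br c I x y) := by
      have := h.continuous
      fun_prop
    exact (hc.tendsto 0).mono_left nhdsWithin_le_nhds
  simp only [zero_add] at h1
  refine tendsto_nhds_unique (h1.congr' ?_) h0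
  filter_upwards [h.eventually_ne 0, h.eventually_generic c x y] with l hl hlg
  simp only [Function.comp, id]
  rw [h.det_kronecker_add_shift l c (-1) x y hx hxy hxyc hlg]
  have := cauchyProd_ne_zero x y hx hy hxy
  rw [mul_left_comm, inv_mul_cancel_left₀ this, Finset.mul_sum]
  refine Finset.sum_congr rfl fun I _ => ?_
  field_simp

/-- The alternating subset identity behind the Wronski-type relations. -/
theorem sum_alternating (h : IsBracket br) {m : ℕ} (c : ℂ) (x y : Fin m → ℂ)
    (hx : ∀ i j, i ≠ j → br (x i - x j) ≠ 0) (hy : ∀ i j, i ≠ j → br (y i - y j) ≠ 0)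
    (hxyc : ∀ i j, br (x i + y j + c) ≠ 0) :
    ∑ I : Finset (Fin m), (-1) ^ #I * br (∑ i, (x i + y i) + (#I : ℂ) * c)
      * (dcoef br c I x * dker br c I x y) = 0 := by
  let F : ℂ → ℂ := fun t => ∑ I : Finset (Fin m),
    (-1) ^ #I * br (∑ i, (x i + (y i + t)) + (#I : ℂ) * c)
      * (dcoef br c I x * dker br c I x (fun i => y i + t))
  have hF : ContinuousAt F 0 := by
    have hb := h.continuous
    refine tendsto_finsetSum _ fun I _ => ?_
    refine ContinuousAt.mul (by fun_prop) (ContinuousAt.mul continuousAt_const ?_)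
    refine tendsto_finsetProd _ fun i _ => tendsto_finsetProd _ fun k _ => ?_
    refine ContinuousAt.div (by fun_prop) (by fun_prop) ?_
    simpa using hxyc i k
  have hF0 : ∀ᶠ t in nhdsWithin (0 : ℂ) {0}ᶜ, F t = 0 := by
    have h1 : ∀ᶠ t in nhdsWithin (0 : ℂ) {0}ᶜ, ∀ i j, br (x i + y j + t) ≠ 0 :=
      Filter.eventually_all.mpr fun i => Filter.eventually_all.mpr fun j =>
        h.eventually_add_ne _
    have h2 : ∀ᶠ t in nhdsWithin (0 : ℂ) {0}ᶜ, ∀ i j, br (x i + y j + c + t) ≠ 0 :=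
      Filter.eventually_all.mpr fun i => Filter.eventually_all.mpr fun j =>
        h.eventually_add_ne _
    filter_upwards [h1, h2] with t ht1 ht2
    refine h.sum_alternating_of_ne_zero c x (fun i => y i + t) hx (fun i j hij => ?_)
      (fun i j => ?_) (fun i j => ?_)
    · simpa using hy i j hij
    · rw [← add_assoc]; exact ht1 i j
    · have := ht2 i j
      rwa [add_right_comm, add_assoc (x i)] at this
  have := tendsto_nhds_unique ((hF.tendsto.mono_left nhdsWithin_le_nhds).congr' hF0)
    tendsto_const_nhds
  simpa [F] using this

end IsBracket

theorem sfac_natCast (br : ℂ → ℂ) (a X : ℂ) (n : ℕ) :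
    sfac br a X n = ∏ i ∈ range n, br (X + (i : ℂ) * a) := by
  simp [sfac]

theorem sfac_zero (br : ℂ → ℂ) (a X : ℂ) : sfac br a X 0 = 1 := by
  simp [sfac]

theorem sfac_natCast_add (br : ℂ → ℂ) (a X : ℂ) (p q : ℕ) :
    sfac br a X ((p + q : ℕ) : ℤ) = sfac br a X p * sfac br a (X + (p : ℂ) * a) q := by
  simp only [sfac_natCast, Finset.prod_range_add]
  congr 1
  refine Finset.prod_congr rfl fun i _ => ?_
  congr 1
  push_cast
  ring

theorem sfac_add_one {br : ℂ → ℂ} {a X : ℂ} (hX : ∀ n : ℤ, br (X + n * a) ≠ 0) (n : ℤ) :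
    sfac br a X (n + 1) = sfac br a X n * br (X + n * a) := by
  rcases lt_or_ge n 0 with hn | hn
  · obtain ⟨k, rfl⟩ : ∃ k : ℕ, n = -((k : ℤ) + 1) := ⟨(-n - 1).toNat, by omega⟩
    have hk : sfac br a X (-((k : ℤ) + 1) + 1)
        = (∏ i ∈ range k, br (X + (-(k : ℂ) + i) * a))⁻¹ := by
      rcases Nat.eq_zero_or_pos k with rfl | hk
      · simp [sfac]
      · have e : (-((k : ℤ) + 1) + 1) = -(k : ℤ) := by ring
        rw [e, sfac, if_neg (by omega)]
        simp
    have hk' : sfac br a X (-((k : ℤ) + 1))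
        = (∏ i ∈ range (k + 1), br (X + (-((k : ℂ) + 1) + i) * a))⁻¹ := by
      have e : (-(-((k : ℤ) + 1))).toNat = k + 1 := by omega
      rw [sfac, if_neg (by omega), e]
      push_cast
      rfl
    rw [hk, hk', Finset.prod_range_succ']
    have h0 := hX (-((k : ℤ) + 1))
    push_cast at h0 ⊢
    rw [add_zero, mul_inv, mul_assoc, inv_mul_cancel₀ h0, mul_one]
    congr 1
    refine Finset.prod_congr rfl fun i _ => ?_
    congr 1
    ring
  · lift n to ℕ using hn
    have : ((n : ℤ) + 1) = ((n + 1 : ℕ) : ℤ) := by push_cast; ring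
    rw [this, sfac_natCast, sfac_natCast, Finset.prod_range_succ]
    simp

theorem sfac_add_one' {br : ℂ → ℂ} {a X : ℂ} (hX : ∀ n : ℤ, br (X + n * a) ≠ 0) (n : ℤ) :
    sfac br a X (n + 1) = br X * sfac br a (X + a) n := by
  have hX' : ∀ n : ℤ, br (X + a + n * a) ≠ 0 := fun n => by
    have := hX (n + 1)
    push_cast at this
    convert this using 2
    ring
  have e : ∀ n : ℤ, br (X + a + n * a) = br (X + ((n + 1 : ℤ) : ℂ) * a) := fun n => by
    push_cast
    congr 1
    ring
  induction n using Int.induction_on with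
  | zero =>
    rw [sfac_add_one hX]
    simp [sfac_zero]
  | succ n ih => rw [sfac_add_one hX, ih, sfac_add_one hX', e, mul_assoc]
  | pred n ih =>
    have h1 := sfac_add_one hX (-(n : ℤ))
    have h2 := sfac_add_one hX' (-(n : ℤ) - 1)
    rw [e] at h2
    rw [sub_add_cancel] at h2 ⊢
    rw [ih, h2, ← mul_assoc] at h1
    exact (mul_right_cancel₀ (hX _) h1).symm

theorem sfac_ne_zero {br : ℂ → ℂ} {a X : ℂ} (hX : ∀ n : ℤ, br (X + n * a) ≠ 0) (n : ℤ) :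
    sfac br a X n ≠ 0 := by
  unfold sfac
  split_ifs with hn
  · exact Finset.prod_ne_zero_iff.mpr fun i _ => by simpa using hX i
  · refine inv_ne_zero (Finset.prod_ne_zero_iff.mpr fun i _ => ?_)
    have := hX (n + i)
    push_cast at this
    exact this

/-- No translate of `X` by the lattice spanned by `δ` and `κ` is a zero of the bracket. -/
def LatticeNe (br : ℂ → ℂ) (δ κ X : ℂ) : Prop :=
  ∀ a b : ℤ, br (X + a * δ + b * κ) ≠ 0

namespace LatticeNe

variable {br : ℂ → ℂ} {δ κ X : ℂ}

theorem ne (h : LatticeNe br δ κ X) {Y : ℂ} (a b : ℤ) (hY : Y = X + a * δ + b * κ) :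
    br Y ≠ 0 := hY ▸ h a b

theorem translate (h : LatticeNe br δ κ X) {Y : ℂ} (a b : ℤ) (hY : Y = X + a * δ + b * κ) :
    LatticeNe br δ κ Y := fun a' b' => h.ne (a + a') (b + b') (by rw [hY]; push_cast; ring)

theorem string (h : LatticeNe br δ κ X) (n : ℤ) : br (X + n * δ) ≠ 0 :=
  h.ne n 0 (by push_cast; ring)

end LatticeNe

/-- The `(i, j)` factor of the coefficients of the Noumi–Sano operators. -/
noncomputable def pairFactor (br : ℂ → ℂ) (δ κ X : ℂ) (a b : ℤ) : ℂ :=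
  sfac br δ (X + δ) (a - b) / sfac br δ (X + κ) (a - b)
    * (sfac br δ (X + κ) a / sfac br δ (X + δ) a)

section pairFactor

variable {br : ℂ → ℂ} {δ κ X : ℂ}

theorem pairFactor_diag_succ (n : ℕ) (hδ : ∀ n : ℕ, 1 ≤ n → br ((n : ℂ) * δ) ≠ 0)
    (hκ : ∀ n : ℤ, br (n * δ + κ) ≠ 0) :
    pairFactor br δ κ 0 n n
      = pairFactor br δ κ 0 (n + 1 : ℕ) (n + 1 : ℕ)
        * (br (((n : ℂ) + 1) * δ) / br (((n : ℂ) + 1) * δ - (δ - κ))) := by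
  have h1 := hδ (n + 1) (by omega)
  have h2 := hκ n
  have e1 : 0 + δ + (n : ℂ) * δ = ((n + 1 : ℕ) : ℂ) * δ := by push_cast; ring
  have e2 : 0 + κ + (n : ℂ) * δ = (n : ℂ) * δ + κ := by ring
  have e3 : ((n : ℂ) + 1) * δ - (δ - κ) = (n : ℂ) * δ + κ := by ring
  have e4 : ((n : ℂ) + 1) * δ = ((n + 1 : ℕ) : ℂ) * δ := by push_cast; ring
  push_cast at h2
  rw [e3, e4]
  simp only [pairFactor, sub_self, sfac_zero]
  rw [sfac_natCast_add br δ (0 + κ) n 1, sfac_natCast_add br δ (0 + δ) n 1, e1, e2]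
  have e5 : ∀ Y : ℂ, sfac br δ Y ((1 : ℕ) : ℤ) = br Y := fun Y => by
    rw [sfac_natCast]; simp
  rw [e5, e5]
  generalize br ((n : ℂ) * δ + κ) = p at h2 ⊢
  generalize br (((n + 1 : ℕ) : ℂ) * δ) = q at h1 ⊢
  field_simp

theorem pairFactor_succ_succ (h : LatticeNe br δ κ X) (a b : ℤ) :
    pairFactor br δ κ X a b = pairFactor br δ κ X (a + 1) (b + 1)
      * (br (X + (a + 1) * δ) / br (X + (a + 1) * δ - (δ - κ))) := by
  have hd : LatticeNe br δ κ (X + δ) := h.translate 1 0 (by push_cast; ring)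
  have hk : LatticeNe br δ κ (X + κ) := h.translate 0 1 (by push_cast; ring)
  have e1 : X + (a + 1) * δ = X + δ + a * δ := by ring
  have e2 : X + δ + a * δ - (δ - κ) = X + κ + a * δ := by ring
  unfold pairFactor
  rw [add_sub_add_right_eq_sub, sfac_add_one hd.string, sfac_add_one hk.string, e1, e2]
  have hda := hd.string a
  have hka := hk.string a
  have := sfac_ne_zero hd.string a
  have := sfac_ne_zero hk.string (a - b)
  generalize br (X + δ + a * δ) = p at hda ⊢
  generalize br (X + κ + a * δ) = q at hka ⊢
  field_simp

theorem pairFactor_shift_left (h : LatticeNe br δ κ X) (a b : ℤ) :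
    pairFactor br δ κ (X + δ) a b = pairFactor br δ κ X (a + 1) b := by
  have hd : LatticeNe br δ κ (X + δ) := h.translate 1 0 (by push_cast; ring)
  have hk : LatticeNe br δ κ (X + κ) := h.translate 0 1 (by push_cast; ring)
  have hdd : LatticeNe br δ κ (X + δ + δ) := hd.translate 1 0 (by push_cast; ring)
  have hkd : LatticeNe br δ κ (X + κ + δ) := hk.translate 1 0 (by push_cast; ring)
  unfold pairFactor
  rw [add_sub_right_comm, sfac_add_one' hd.string, sfac_add_one' hk.string,
    sfac_add_one' hd.string, sfac_add_one' hk.string, add_right_comm X δ κ]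
  have := hd.ne (Y := X + δ) 0 0 (by push_cast; ring)
  have := hk.ne (Y := X + κ) 0 0 (by push_cast; ring)
  have := sfac_ne_zero hdd.string a
  have := sfac_ne_zero hkd.string (a - b)
  field_simp

theorem pairFactor_succ_left (h : LatticeNe br δ κ X) (a b : ℤ) :
    pairFactor br δ κ X a b = pairFactor br δ κ X (a + 1) b
      * (br (X + (a + 1) * δ) / br (X + (a + 1) * δ - (δ - κ)))
      * (br (X + (a + 1 - b) * δ - (δ - κ)) / br (X + (a + 1 - b) * δ)) := by
  have hd : LatticeNe br δ κ (X + δ) := h.translate 1 0 (by push_cast; ring)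
  have hk : LatticeNe br δ κ (X + κ) := h.translate 0 1 (by push_cast; ring)
  have e1 : X + (a + 1) * δ = X + δ + a * δ := by ring
  have e2 : X + δ + a * δ - (δ - κ) = X + κ + a * δ := by ring
  have e3 : X + (a + 1 - b) * δ = X + δ + ((a - b : ℤ) : ℂ) * δ := by push_cast; ring
  have e4 : X + δ + ((a - b : ℤ) : ℂ) * δ - (δ - κ) = X + κ + ((a - b : ℤ) : ℂ) * δ := by ring
  unfold pairFactor
  rw [add_sub_right_comm, sfac_add_one hd.string, sfac_add_one hk.string,
    sfac_add_one hd.string, sfac_add_one hk.string, e1, e2, e3, e4]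
  have hda := hd.string a
  have hka := hk.string a
  have hdb := hd.string (a - b)
  have hkb := hk.string (a - b)
  have := sfac_ne_zero hd.string a
  have := sfac_ne_zero hk.string (a - b)
  generalize br (X + δ + a * δ) = p at hda ⊢
  generalize br (X + κ + a * δ) = q at hka ⊢
  generalize br (X + δ + ((a - b : ℤ) : ℂ) * δ) = r at hdb ⊢
  generalize br (X + κ + ((a - b : ℤ) : ℂ) * δ) = s at hkb ⊢
  field_simp

theorem pairFactor_succ_right (h : LatticeNe br δ κ X) (a b : ℤ) :
    pairFactor br δ κ X a b = pairFactor br δ κ X a (b + 1)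
      * (br (X + (a - b) * δ) / br (X + (a - b) * δ - (δ - κ))) := by
  have hd : LatticeNe br δ κ (X + δ) := h.translate 1 0 (by push_cast; ring)
  have hk : LatticeNe br δ κ (X + κ) := h.translate 0 1 (by push_cast; ring)
  have e : a - b = a - (b + 1) + 1 := by ring
  have e3 : X + (a - b) * δ = X + δ + ((a - (b + 1) : ℤ) : ℂ) * δ := by push_cast; ring
  have e4 : X + δ + ((a - (b + 1) : ℤ) : ℂ) * δ - (δ - κ)
      = X + κ + ((a - (b + 1) : ℤ) : ℂ) * δ := by ring
  unfold pairFactor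
  rw [e, sfac_add_one hd.string, sfac_add_one hk.string, e3, e4]
  have := hd.string (a - (b + 1))
  have := hk.string (a - (b + 1))
  have := sfac_ne_zero hd.string a
  have := sfac_ne_zero hk.string (a - (b + 1))
  field_simp

theorem pairFactor_shift_right (h : LatticeNe br δ κ X) (a b : ℤ) :
    pairFactor br δ κ (X - δ) a b = pairFactor br δ κ X a (b + 1)
      * (br (X + a * δ) / br (X + a * δ - (δ - κ))) := by
  have h' : LatticeNe br δ κ (X - δ) := h.translate (-1) 0 (by push_cast; ring)
  have e := pairFactor_shift_left h' a (b + 1)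
  rw [sub_add_cancel] at e
  rw [e, pairFactor_succ_succ h']
  have e1 : X - δ + (a + 1) * δ = X + a * δ := by ring
  rw [e1]

end pairFactor

/-- The indicator vector of `I`. -/
def indVec {m : ℕ} (I : Finset (Fin m)) : Fin m → ℕ := fun i => if i ∈ I then 1 else 0

/-- The translate `x + δ μ`. -/
noncomputable def latticeShift {m : ℕ} (δ : ℂ) (μ : Fin m → ℕ) (x : Fin m → ℂ) : Fin m → ℂ :=
  fun i => x i + (μ i : ℂ) * δ

/-- The coefficients of the Noumi–Sano operators. -/
noncomputable def hcoef (br : ℂ → ℂ) (δ κ : ℂ) {m : ℕ} (μ : Fin m → ℕ) (x : Fin m → ℂ) : ℂ :=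
  ∏ i, ∏ j, pairFactor br δ κ (x i - x j) (μ i) (μ j)

/-- The ratio of values of the kernel function at `x + δ μ` and at `x`. -/
noncomputable def kernelRatio (br : ℂ → ℂ) (δ κ : ℂ) {m : ℕ} (μ : Fin m → ℕ)
    (x z : Fin m → ℂ) : ℂ :=
  ∏ i, ∏ j, sfac br δ (x i + z j) (μ i) / sfac br δ (x i + z j + δ - κ) (μ i)

theorem LSWterm_eq (br : ℂ → ℂ) (δ κ : ℂ) {m : ℕ} (μ : Fin m → ℕ) (x z : Fin m → ℂ) :
    LSWterm br δ κ μ x z = hcoef br δ κ μ x * kernelRatio br δ κ μ x z := by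
  simp only [LSWterm, hcoef, kernelRatio, pairFactor, ← Finset.prod_mul_distrib]
  refine Finset.prod_congr rfl fun i _ => Finset.prod_congr rfl fun j _ => ?_
  rw [mul_div_mul_comm, mul_assoc]

theorem prod_prod_ite_compl {m : ℕ} (I : Finset (Fin m)) (f : Fin m → Fin m → ℂ) :
    ∏ i, ∏ j, (if i ∈ I then (if j ∈ Iᶜ then f i j else 1) else 1) = ∏ i ∈ I, ∏ j ∈ Iᶜ, f i j := by
  simp only [Finset.prod_ite_irrel, Finset.prod_const_one, Finset.prod_ite_mem, Finset.univ_inter]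

theorem prod_prod_ite_left {m : ℕ} (I : Finset (Fin m)) (f : Fin m → Fin m → ℂ) :
    ∏ i, ∏ j, (if i ∈ I then f i j else 1) = ∏ i ∈ I, ∏ j, f i j := by
  simp only [Finset.prod_ite_irrel, Finset.prod_const_one, Finset.prod_ite_mem, Finset.univ_inter]

theorem IsBracket.div_eq_div_neg {br : ℂ → ℂ} (h : IsBracket br) {u v u' v' : ℂ} (hu : u' = -u)
    (hv : v' = -v) : br u / br v = br u' / br v' := by
  rw [hu, hv, h.odd, h.odd, neg_div_neg_eq]

section Wronski

variable {br : ℂ → ℂ} {δ κ : ℂ} {m : ℕ}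

theorem hcoef_latticeShift (h : IsBracket br) (hδ : ∀ n : ℕ, 1 ≤ n → br ((n : ℂ) * δ) ≠ 0)
    (hκ : ∀ n : ℤ, br (n * δ + κ) ≠ 0) (x : Fin m → ℂ)
    (hx : ∀ i j, i ≠ j → LatticeNe br δ κ (x i - x j)) (I : Finset (Fin m)) (μ : Fin m → ℕ) :
    hcoef br δ κ μ (latticeShift δ (indVec I) x)
      = hcoef br δ κ (μ + indVec I) x
        * dker br (δ - κ) I x (-latticeShift δ (μ + indVec I) x) := by
  rw [dker, ← prod_prod_ite_left, Finset.prod_comm (f := fun i k => if i ∈ I then _ else _)]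
  simp only [hcoef, ← Finset.prod_mul_distrib]
  refine Finset.prod_congr rfl fun i _ => Finset.prod_congr rfl fun j _ => ?_
  rcases eq_or_ne i j with rfl | hij
  · by_cases hi : i ∈ I
    · simp only [hi, sub_self, Pi.add_apply, Pi.neg_apply, indVec, latticeShift, if_true]
      rw [pairFactor_diag_succ _ hδ hκ]
      congr 1
      apply h.div_eq_div_neg <;> push_cast <;> ring
    · simp [hi, indVec]
  · have hX := hx i j hij
    by_cases hi : i ∈ I <;> by_cases hj : j ∈ I <;>
      simp only [hi, hj, Pi.add_apply, Pi.neg_apply, indVec, latticeShift, if_true, if_false,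
        Nat.cast_one, Nat.cast_zero, one_mul, zero_mul, add_zero, mul_one,
        add_sub_add_right_eq_sub, Nat.cast_add]
    · rw [pairFactor_succ_succ hX]
      congr 1
      apply h.div_eq_div_neg <;> push_cast <;> ring
    · rw [add_sub_right_comm, pairFactor_shift_left hX]
    · rw [← sub_sub, pairFactor_shift_right hX]
      congr 1
      apply h.div_eq_div_neg <;> push_cast <;> ring

theorem hcoef_mul_dcoef (h : IsBracket br) (hδ : ∀ n : ℕ, 1 ≤ n → br ((n : ℂ) * δ) ≠ 0)
    (hκ : ∀ n : ℤ, br (n * δ + κ) ≠ 0) (x : Fin m → ℂ)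
    (hx : ∀ i j, i ≠ j → LatticeNe br δ κ (x i - x j)) (I : Finset (Fin m)) (μ : Fin m → ℕ) :
    hcoef br δ κ μ x * dcoef br (δ - κ) I (latticeShift δ μ x)
      = hcoef br δ κ (μ + indVec I) x
        * (dcoef br (-(δ - κ)) I (latticeShift δ (μ + indVec I) x)
          * dker br (-(δ - κ)) I (latticeShift δ (μ + indVec I) x) (-x)) := by
  rw [dker, ← prod_prod_ite_left, dcoef, dcoef, ← prod_prod_ite_compl, ← prod_prod_ite_compl,
    Finset.prod_comm (f := fun i j => if i ∈ I then
      (if j ∈ Iᶜ then br (latticeShift δ μ x i - latticeShift δ μ x j + (δ - κ))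
        / br (latticeShift δ μ x i - latticeShift δ μ x j) else 1) else 1)]
  simp only [hcoef, ← Finset.prod_mul_distrib]
  refine Finset.prod_congr rfl fun i _ => Finset.prod_congr rfl fun j _ => ?_
  rcases eq_or_ne i j with rfl | hij
  · by_cases hi : i ∈ I
    · simp only [hi, sub_self, Pi.add_apply, Pi.neg_apply, indVec, latticeShift, if_true,
        Finset.mem_compl, not_true, if_false, mul_one, one_mul]
      rw [pairFactor_diag_succ _ hδ hκ]
      congr 3 <;> push_cast <;> ring
    · simp [hi, indVec]
  · have hX := hx i j hij
    by_cases hi : i ∈ I <;> by_cases hj : j ∈ I <;>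
      simp only [hi, hj, Pi.add_apply, Pi.neg_apply, indVec, latticeShift, if_true, if_false,
        Nat.cast_one, one_mul, add_zero, mul_one, Finset.mem_compl,
        not_true, not_false_eq_true, Nat.cast_add]
    · rw [pairFactor_succ_succ hX]
      congr 3 <;> push_cast <;> ring
    · rw [pairFactor_succ_left hX, mul_assoc, mul_comm (_ / _)]
      congr 4 <;> push_cast <;> ring
    · rw [pairFactor_succ_right hX, mul_assoc]
      have e1 : x i - x j + (((μ i : ℤ) : ℂ) - ((μ j : ℤ) : ℂ)) * δ
          = -(x j + (μ j : ℂ) * δ - (x i + (μ i : ℂ) * δ)) := by push_cast; ring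
      have e2 : x i - x j + (((μ i : ℤ) : ℂ) - ((μ j : ℤ) : ℂ)) * δ - (δ - κ)
          = -(x j + (μ j : ℂ) * δ - (x i + (μ i : ℂ) * δ) + (δ - κ)) := by push_cast; ring
      have n1 := hX.ne (Y := x i - x j + (((μ i : ℤ) : ℂ) - ((μ j : ℤ) : ℂ)) * δ)
        (μ i - μ j) 0 (by push_cast; ring)
      have n2 := hX.ne (Y := x i - x j + (((μ i : ℤ) : ℂ) - ((μ j : ℤ) : ℂ)) * δ - (δ - κ))
        (μ i - μ j - 1) 1 (by push_cast; ring)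
      rw [e1, h.odd] at n1
      rw [e2, h.odd] at n2
      rw [e2, e1, h.odd, h.odd, neg_div_neg_eq,
        div_mul_div_cancel₀ (neg_ne_zero.mp n2), div_self (neg_ne_zero.mp n1), mul_one]

theorem latticeShift_sub_ne (x : Fin m → ℂ)
    (hx : ∀ i j, i ≠ j → LatticeNe br δ κ (x i - x j)) (μ : Fin m → ℕ) (i j : Fin m)
    (hij : i ≠ j) : LatticeNe br δ κ (latticeShift δ μ x i - latticeShift δ μ x j) :=
  (hx i j hij).translate (μ i - μ j) 0 (by simp only [latticeShift]; push_cast; ring)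

theorem latticeShift_sub_self_ne (hκ : ∀ n : ℤ, br (n * δ + κ) ≠ 0) (x : Fin m → ℂ)
    (hx : ∀ i j, i ≠ j → LatticeNe br δ κ (x i - x j)) (ν : Fin m → ℕ) (i j : Fin m) :
    br (latticeShift δ ν x i - x j - (δ - κ)) ≠ 0 := by
  rcases eq_or_ne i j with rfl | hij
  · convert hκ (ν i - 1) using 2
    simp only [latticeShift]
    push_cast
    ring
  · exact (hx i j hij).ne (ν i - 1) 1 (by simp only [latticeShift]; push_cast; ring)

theorem sub_indVec_add {ν : Fin m → ℕ} {I : Finset (Fin m)} (hI : ∀ i ∈ I, 1 ≤ ν i) :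
    ν - indVec I + indVec I = ν := by
  funext i
  by_cases hi : i ∈ I
  · simpa [indVec, hi] using Nat.sub_add_cancel (hI i hi)
  · simp [indVec, hi]

theorem sum_dcoef_mul_hcoef (h : IsBracket br) (hδ : ∀ n : ℕ, 1 ≤ n → br ((n : ℂ) * δ) ≠ 0)
    (hκ : ∀ n : ℤ, br (n * δ + κ) ≠ 0) (x : Fin m → ℂ)
    (hx : ∀ i j, i ≠ j → LatticeNe br δ κ (x i - x j)) (ν : Fin m → ℕ) :
    ∑ I : Finset (Fin m) with ∀ i ∈ I, 1 ≤ ν i,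
      (-1) ^ #I * br (((∑ i, ν i : ℕ) : ℂ) * δ - #I * (δ - κ))
        * (dcoef br (δ - κ) I x
          * hcoef br δ κ (ν - indVec I) (latticeShift δ (indVec I) x)) = 0 := by
  have hne : ∀ i j, i ≠ j → br (x i - x j) ≠ 0 := fun i j hij =>
    (hx i j hij).ne 0 0 (by push_cast; ring)
  have key := h.sum_alternating (δ - κ) x (-latticeShift δ ν x) hne
    (fun i j hij => by
      have := (latticeShift_sub_ne x hx ν j i hij.symm).ne
        (Y := -latticeShift δ ν x i - -latticeShift δ ν x j) 0 0 (by push_cast; ring)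
      simpa using this)
    (fun i j => by
      have e : x i + (-latticeShift δ ν x) j + (δ - κ)
          = -(latticeShift δ ν x j - x i - (δ - κ)) := by simp only [Pi.neg_apply]; ring
      rw [e, h.odd]
      exact neg_ne_zero.mpr (latticeShift_sub_self_ne hκ x hx ν j i))
  rw [← Finset.sum_subset (Finset.filter_subset (fun I => ∀ i ∈ I, 1 ≤ ν i) univ)] at key
  · rw [← mul_zero (-hcoef br δ κ ν x), ← key, Finset.mul_sum]
    refine Finset.sum_congr rfl fun I hI => ?_
    have hI' := (Finset.mem_filter.mp hI).2
    have e : ∑ i, (x i + (-latticeShift δ ν x) i) + (#I : ℂ) * (δ - κ)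
        = -(((∑ i, ν i : ℕ) : ℂ) * δ - #I * (δ - κ)) := by
      simp [latticeShift, Finset.sum_mul]
      ring
    rw [hcoef_latticeShift h hδ hκ x hx, sub_indVec_add hI', e, h.odd]
    ring
  · intro I _ hI
    obtain ⟨i, hi, hνi⟩ : ∃ i ∈ I, ν i = 0 := by simpa using hI
    have : dker br (δ - κ) I x (-latticeShift δ ν x) = 0 := by
      refine Finset.prod_eq_zero hi (Finset.prod_eq_zero (Finset.mem_univ i) ?_)
      simp [latticeShift, hνi, h.map_zero]
    rw [this, mul_zero, mul_zero]

theorem sum_hcoef_mul_dcoef (h : IsBracket br) (hδ : ∀ n : ℕ, 1 ≤ n → br ((n : ℂ) * δ) ≠ 0)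
    (hκ : ∀ n : ℤ, br (n * δ + κ) ≠ 0) (x : Fin m → ℂ)
    (hx : ∀ i j, i ≠ j → LatticeNe br δ κ (x i - x j)) (ν : Fin m → ℕ) :
    ∑ I : Finset (Fin m) with ∀ i ∈ I, 1 ≤ ν i,
      (-1) ^ #I * br (((∑ i, ν i : ℕ) : ℂ) * δ - #I * (δ - κ))
        * (hcoef br δ κ (ν - indVec I) x
          * dcoef br (δ - κ) I (latticeShift δ (ν - indVec I) x)) = 0 := by
  have key := h.sum_alternating (-(δ - κ)) (latticeShift δ ν x) (-x)
    (fun i j hij => (latticeShift_sub_ne x hx ν i j hij).ne 0 0 (by push_cast; ring))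
    (fun i j hij => by
      have := (hx j i hij.symm).ne (Y := -x i - -x j) 0 0 (by push_cast; ring)
      simpa using this)
    (fun i j => by
      have e : latticeShift δ ν x i + (-x) j + -(δ - κ)
          = latticeShift δ ν x i - x j - (δ - κ) := by simp only [Pi.neg_apply]; ring
      rw [e]
      exact latticeShift_sub_self_ne hκ x hx ν i j)
  rw [← Finset.sum_subset (Finset.filter_subset (fun I => ∀ i ∈ I, 1 ≤ ν i) univ)] at key
  · rw [← mul_zero (hcoef br δ κ ν x), ← key, Finset.mul_sum]
    refine Finset.sum_congr rfl fun I hI => ?_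
    have hI' := (Finset.mem_filter.mp hI).2
    have e : ∑ i, (latticeShift δ ν x i + (-x) i) + (#I : ℂ) * -(δ - κ)
        = ((∑ i, ν i : ℕ) : ℂ) * δ - #I * (δ - κ) := by
      simp [latticeShift, Finset.sum_mul]
      ring
    rw [hcoef_mul_dcoef h hδ hκ x hx, sub_indVec_add hI', e]
    ring
  · intro I _ hI
    obtain ⟨i, hi, hνi⟩ : ∃ i ∈ I, ν i = 0 := by simpa using hI
    have : dker br (-(δ - κ)) I (latticeShift δ ν x) (-x) = 0 := by
      refine Finset.prod_eq_zero hi (Finset.prod_eq_zero (Finset.mem_univ i) ?_)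
      simp [latticeShift, hνi, h.map_zero]
    rw [this, mul_zero, mul_zero]

end Wronski

theorem mem_muSet {m k : ℕ} {μ : Fin m → ℕ} : μ ∈ muSet m k ↔ ∑ i, μ i = k := by
  simp only [muSet, Finset.mem_filter, Fintype.mem_piFinset, Finset.mem_range, and_iff_right_iff_imp]
  rintro rfl i
  exact Nat.lt_succ_of_le (Finset.single_le_sum (fun j _ => Nat.zero_le (μ j)) (Finset.mem_univ i))

theorem sum_indVec {m : ℕ} (I : Finset (Fin m)) : ∑ i, indVec I i = #I := by
  simp [indVec]

/-- Pairs `(I, μ)` with `#I + |μ| = k` correspond to pairs `(ν, I)` with `|ν| = k` and `I` contained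
in the support of `ν`, through `ν = μ + indVec I`. -/
theorem sum_antidiagonal_eq_sum_muSet {m : ℕ} (k : ℕ)
    (G : Finset (Fin m) → (Fin m → ℕ) → ℂ) :
    ∑ p ∈ antidiagonal k, ∑ I ∈ powersetCard p.1 univ, ∑ μ ∈ muSet m p.2, G I μ
      = ∑ ν ∈ muSet m k, ∑ I : Finset (Fin m) with ∀ i ∈ I, 1 ≤ ν i, G I (ν - indVec I) := by
  simp only [Finset.sum_sigma']
  refine Finset.sum_nbij' (fun q => ⟨q.2.2 + indVec q.2.1, q.2.1⟩)
    (fun q => ⟨(#q.2, ∑ i, (q.1 - indVec q.2) i), q.2, q.1 - indVec q.2⟩) ?_ ?_ ?_ ?_ ?_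
  · rintro ⟨⟨r, s⟩, I, μ⟩ hq
    simp only [Finset.mem_sigma, HasAntidiagonal.mem_antidiagonal, Finset.mem_powersetCard,
      mem_muSet, Finset.mem_filter, Finset.mem_univ, true_and] at hq ⊢
    refine ⟨?_, fun i hi => by simp [indVec, hi]⟩
    simp only [Pi.add_apply, Finset.sum_add_distrib, sum_indVec]
    omega
  · rintro ⟨ν, I⟩ hq
    simp only [Finset.mem_sigma, HasAntidiagonal.mem_antidiagonal, Finset.mem_powersetCard,
      mem_muSet, Finset.mem_filter, Finset.mem_univ, true_and] at hq ⊢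
    refine ⟨?_, by simp⟩
    have := congrArg (fun v : Fin m → ℕ => ∑ i, v i) (sub_indVec_add hq.2)
    simp only [Pi.add_apply, Finset.sum_add_distrib, sum_indVec] at this
    omega
  · rintro ⟨⟨r, s⟩, I, μ⟩ hq
    simp only [Finset.mem_sigma, HasAntidiagonal.mem_antidiagonal, Finset.mem_powersetCard,
      mem_muSet] at hq
    obtain ⟨-, ⟨-, rfl⟩, rfl⟩ := hq
    simp
  · rintro ⟨ν, I⟩ hq
    simp only [Finset.mem_sigma, Finset.mem_filter] at hq
    simp [sub_indVec_add hq.2.2]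
  · rintro ⟨⟨r, s⟩, I, μ⟩ _
    simp

section kernel

variable {br : ℂ → ℂ} {δ κ : ℂ} {m : ℕ}

theorem kernelRatio_indVec (I : Finset (Fin m)) (x z : Fin m → ℂ) :
    kernelRatio br δ κ (indVec I) x z = dker br (δ - κ) I x z := by
  rw [dker, ← prod_prod_ite_left]
  refine Finset.prod_congr rfl fun i _ => Finset.prod_congr rfl fun j _ => ?_
  by_cases hi : i ∈ I
  · simp only [indVec, hi, if_true, sfac_natCast, add_sub_assoc]
    simp
  · simp [indVec, hi, sfac_zero]

theorem sfac_div_add (u : ℂ) (a b : ℕ) :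
    sfac br δ u ((a + b : ℕ) : ℤ) / sfac br δ (u + δ - κ) ((a + b : ℕ) : ℤ)
      = sfac br δ u a / sfac br δ (u + δ - κ) a
        * (sfac br δ (u + a * δ) b / sfac br δ (u + a * δ + δ - κ) b) := by
  rw [sfac_natCast_add, sfac_natCast_add, mul_div_mul_comm]
  congr 3
  ring

theorem kernelRatio_add (μ ν : Fin m → ℕ) (x z : Fin m → ℂ) :
    kernelRatio br δ κ μ x z * kernelRatio br δ κ ν (latticeShift δ μ x) z
      = kernelRatio br δ κ (μ + ν) x z := by
  simp only [kernelRatio, ← Finset.prod_mul_distrib]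
  refine Finset.prod_congr rfl fun i _ => Finset.prod_congr rfl fun j _ => ?_
  have e : latticeShift δ μ x i + z j = x i + z j + μ i * δ := by simp only [latticeShift]; ring
  rw [e, Pi.add_apply, sfac_div_add]

theorem kernelRatio_cross (μ ν : Fin m → ℕ) (x z : Fin m → ℂ) :
    kernelRatio br δ κ ν x z * kernelRatio br δ κ μ z (latticeShift δ ν x)
      = kernelRatio br δ κ μ z x * kernelRatio br δ κ ν x (latticeShift δ μ z) := by
  unfold kernelRatio
  rw [Finset.prod_comm (f := fun i j => sfac br δ (z i + latticeShift δ ν x j) _ / _),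
    Finset.prod_comm (f := fun i j => sfac br δ (z i + x j) _ / _)]
  simp only [← Finset.prod_mul_distrib]
  refine Finset.prod_congr rfl fun i _ => Finset.prod_congr rfl fun j _ => ?_
  have e1 : z j + latticeShift δ ν x i = x i + z j + ν i * δ := by simp only [latticeShift]; ring
  have e2 : x i + latticeShift δ μ z j = x i + z j + μ j * δ := by simp only [latticeShift]; ring
  rw [e1, e2, add_comm (z j), ← sfac_div_add, ← sfac_div_add, add_comm (ν i)]

/-- Alternating sums over Ruijsenaars operators composed with Noumi–Sano operators (with the latter
acting first on the coefficients' side) vanish. -/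
theorem wronski_left (h : IsBracket br) (hδ : ∀ n : ℕ, 1 ≤ n → br ((n : ℂ) * δ) ≠ 0)
    (hκ : ∀ n : ℤ, br (n * δ + κ) ≠ 0) (x z : Fin m → ℂ)
    (hx : ∀ i j, i ≠ j → LatticeNe br δ κ (x i - x j)) (k : ℕ) :
    ∑ p ∈ antidiagonal k, (-1) ^ p.1 * br ((k : ℂ) * δ - p.1 * (δ - κ))
      * ∑ I ∈ powersetCard p.1 univ, ∑ μ ∈ muSet m p.2,
        dcoef br (δ - κ) I x * kernelRatio br δ κ (indVec I) x z
          * (hcoef br δ κ μ (latticeShift δ (indVec I) x)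
            * kernelRatio br δ κ μ (latticeShift δ (indVec I) x) z) = 0 := by
  have := sum_antidiagonal_eq_sum_muSet (m := m) k fun I μ =>
    (-1) ^ #I * br ((k : ℂ) * δ - #I * (δ - κ))
      * (dcoef br (δ - κ) I x * kernelRatio br δ κ (indVec I) x z
          * (hcoef br δ κ μ (latticeShift δ (indVec I) x)
            * kernelRatio br δ κ μ (latticeShift δ (indVec I) x) z))
  trans
  · refine Eq.trans (Finset.sum_congr rfl fun p _ => ?_) this
    simp only [Finset.mul_sum]
    refine Finset.sum_congr rfl fun I hI => ?_
    rw [(Finset.mem_powersetCard.mp hI).2]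
  refine Finset.sum_eq_zero fun ν hν => ?_
  have hw := sum_dcoef_mul_hcoef h hδ hκ x hx ν
  rw [mem_muSet.mp hν] at hw
  rw [← mul_zero (kernelRatio br δ κ ν x z), ← hw, Finset.mul_sum]
  refine Finset.sum_congr rfl fun I hI => ?_
  have hk := kernelRatio_add (br := br) (δ := δ) (κ := κ) (indVec I) (ν - indVec I) x z
  rw [add_comm, sub_indVec_add (Finset.mem_filter.mp hI).2] at hk
  rw [← hk]
  ring

theorem wronski_right (h : IsBracket br) (hδ : ∀ n : ℕ, 1 ≤ n → br ((n : ℂ) * δ) ≠ 0)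
    (hκ : ∀ n : ℤ, br (n * δ + κ) ≠ 0) (x z : Fin m → ℂ)
    (hx : ∀ i j, i ≠ j → LatticeNe br δ κ (x i - x j)) (k : ℕ) :
    ∑ p ∈ antidiagonal k, (-1) ^ p.1 * br ((k : ℂ) * δ - p.1 * (δ - κ))
      * ∑ I ∈ powersetCard p.1 univ, ∑ μ ∈ muSet m p.2,
        hcoef br δ κ μ x * kernelRatio br δ κ μ x z
          * (dcoef br (δ - κ) I (latticeShift δ μ x)
            * kernelRatio br δ κ (indVec I) (latticeShift δ μ x) z) = 0 := by
  have := sum_antidiagonal_eq_sum_muSet (m := m) k fun I μ =>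
    (-1) ^ #I * br ((k : ℂ) * δ - #I * (δ - κ))
      * (hcoef br δ κ μ x * kernelRatio br δ κ μ x z
          * (dcoef br (δ - κ) I (latticeShift δ μ x)
            * kernelRatio br δ κ (indVec I) (latticeShift δ μ x) z))
  trans
  · refine Eq.trans (Finset.sum_congr rfl fun p _ => ?_) this
    simp only [Finset.mul_sum]
    refine Finset.sum_congr rfl fun I hI => ?_
    rw [(Finset.mem_powersetCard.mp hI).2]
  refine Finset.sum_eq_zero fun ν hν => ?_
  have hw := sum_hcoef_mul_dcoef h hδ hκ x hx ν
  rw [mem_muSet.mp hν] at hw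
  rw [← mul_zero (kernelRatio br δ κ ν x z), ← hw, Finset.mul_sum]
  refine Finset.sum_congr rfl fun I hI => ?_
  have hk := kernelRatio_add (br := br) (δ := δ) (κ := κ) (ν - indVec I) (indVec I) x z
  rw [sub_indVec_add (Finset.mem_filter.mp hI).2] at hk
  rw [← hk]
  ring

/-- The kernel identity for the Ruijsenaars operators. -/
theorem sum_dcoef_kernelRatio_comm (h : IsBracket br) (x z : Fin m → ℂ)
    (hx : ∀ i j, i ≠ j → LatticeNe br δ κ (x i - x j))
    (hz : ∀ i j, i ≠ j → LatticeNe br δ κ (z i - z j))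
    (hxz : ∀ i j, LatticeNe br δ κ (x i + z j)) (r : ℕ) :
    ∑ I ∈ powersetCard r univ, dcoef br (δ - κ) I x * kernelRatio br δ κ (indVec I) x z
      = ∑ I ∈ powersetCard r univ, dcoef br (δ - κ) I z * kernelRatio br δ κ (indVec I) z x := by
  simp only [kernelRatio_indVec]
  exact h.sum_dcoef_dker_comm (δ - κ) x z
    (fun i j hij => (hx i j hij).ne 0 0 (by push_cast; ring))
    (fun i j hij => (hz i j hij).ne 0 0 (by push_cast; ring))
    (fun i j => (hxz i j).ne 0 0 (by push_cast; ring))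
    (fun i j => (hxz i j).ne 1 (-1) (by push_cast; ring)) r

/-- The transformation at generic parameters. -/
theorem sum_hcoef_kernelRatio_comm (h : IsBracket br)
    (hδ : ∀ n : ℕ, 1 ≤ n → br ((n : ℂ) * δ) ≠ 0)
    (hκ : ∀ n : ℤ, br (n * δ + κ) ≠ 0) (k : ℕ) (x z : Fin m → ℂ)
    (hx : ∀ i j, i ≠ j → LatticeNe br δ κ (x i - x j))
    (hz : ∀ i j, i ≠ j → LatticeNe br δ κ (z i - z j))
    (hxz : ∀ i j, LatticeNe br δ κ (x i + z j)) :
    ∑ μ ∈ muSet m k, hcoef br δ κ μ x * kernelRatio br δ κ μ x z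
      = ∑ μ ∈ muSet m k, hcoef br δ κ μ z * kernelRatio br δ κ μ z x := by
  induction k using Nat.strong_induction_on generalizing x z with
  | _ k ih =>
    rcases Nat.eq_zero_or_pos k with rfl | hk
    · refine Finset.sum_congr rfl fun μ hμ => ?_
      have : μ = 0 := by
        funext i
        have := mem_muSet.mp hμ
        simpa using (Finset.sum_eq_zero_iff.mp this) i (Finset.mem_univ i)
      simp [this, hcoef, kernelRatio, pairFactor, sfac_zero]
    have hL := wronski_left h hδ hκ x z hx k
    have hR := wronski_right h hδ hκ z x hz k
    have hmem : (0, k) ∈ antidiagonal k := by simp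
    rw [← Finset.add_sum_erase _ _ hmem] at hL hR
    have hrest : ∀ p ∈ (antidiagonal k).erase (0, k),
        ∑ I ∈ powersetCard p.1 univ, ∑ μ ∈ muSet m p.2,
          dcoef br (δ - κ) I x * kernelRatio br δ κ (indVec I) x z
            * (hcoef br δ κ μ (latticeShift δ (indVec I) x)
              * kernelRatio br δ κ μ (latticeShift δ (indVec I) x) z)
        = ∑ I ∈ powersetCard p.1 univ, ∑ μ ∈ muSet m p.2,
          hcoef br δ κ μ z * kernelRatio br δ κ μ z x
            * (dcoef br (δ - κ) I (latticeShift δ μ z)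
              * kernelRatio br δ κ (indVec I) (latticeShift δ μ z) x) := by
      rintro ⟨r, s⟩ hp
      have hs : s < k := by
        simp only [Finset.mem_erase, HasAntidiagonal.mem_antidiagonal, ne_eq, Prod.mk.injEq] at hp
        omega
      calc _ = ∑ I ∈ powersetCard r univ, ∑ μ ∈ muSet m s,
            dcoef br (δ - κ) I x * hcoef br δ κ μ z * (kernelRatio br δ κ (indVec I) x z
              * kernelRatio br δ κ μ z (latticeShift δ (indVec I) x)) := by
            refine Finset.sum_congr rfl fun I _ => ?_
            rw [← Finset.mul_sum, ih s hs (latticeShift δ (indVec I) x) z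
              (latticeShift_sub_ne x hx _) hz (fun i j => (hxz i j).translate (indVec I i) 0
                (by simp only [latticeShift]; push_cast; ring)), Finset.mul_sum]
            exact Finset.sum_congr rfl fun μ _ => by ring
        _ = ∑ μ ∈ muSet m s, hcoef br δ κ μ z * kernelRatio br δ κ μ z x
              * ∑ I ∈ powersetCard r univ, dcoef br (δ - κ) I x
                * kernelRatio br δ κ (indVec I) x (latticeShift δ μ z) := by
            rw [Finset.sum_comm]
            refine Finset.sum_congr rfl fun μ _ => ?_
            rw [Finset.mul_sum]
            refine Finset.sum_congr rfl fun I _ => ?_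
            rw [kernelRatio_cross]
            ring
        _ = _ := by
            rw [Finset.sum_comm]
            refine Finset.sum_congr rfl fun μ _ => ?_
            rw [sum_dcoef_kernelRatio_comm h x (latticeShift δ μ z) hx
              (latticeShift_sub_ne z hz _) (fun i j => (hxz i j).translate (μ j) 0
                (by simp only [latticeShift]; push_cast; ring)), Finset.mul_sum]
    rw [Finset.sum_congr (s₁ := (antidiagonal k).erase (0, k)) rfl
      fun p hp => congrArg _ (hrest p hp)] at hL
    have heq := add_right_cancel (hL.trans hR.symm)
    have h0 : indVec (∅ : Finset (Fin m)) = 0 := by funext i; simp [indVec]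
    have hs0 : ∀ v : Fin m → ℂ, latticeShift δ (0 : Fin m → ℕ) v = v := fun v => by
      funext i; simp [latticeShift]
    have hk0 : ∀ u v : Fin m → ℂ, kernelRatio br δ κ (0 : Fin m → ℕ) u v = 1 := fun u v => by
      simp [kernelRatio, sfac_zero]
    simp only [Finset.powersetCard_zero, Finset.sum_singleton, h0, hs0, hk0, dcoef,
      Finset.prod_empty, pow_zero, one_mul, mul_one, Nat.cast_zero, zero_mul, sub_zero] at heq
    exact mul_left_cancel₀ (hδ k hk) heq

end kernel

instance Filter.countableInterFilter_cocountable {α : Type*} :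
    CountableInterFilter (Filter.cocountable : Filter α) :=
  CardinalInterFilter.toCountableInterFilter _ Cardinal.aleph0_lt_aleph_one

section perturbation

variable {br : ℂ → ℂ} {δ κ : ℂ} {m : ℕ}

theorem IsBracket.countable_setOf_eq_zero (h : IsBracket br) : {z | br z = 0}.Countable := by
  refine (HereditarilyLindelofSpace.isLindelof _).countable_of_isDiscrete ?_
  rw [isDiscrete_iff_nhdsNE]
  intro z _
  rw [Filter.inf_principal_eq_bot]
  filter_upwards [h.eventually_ne z] with t ht using ht

theorem IsBracket.eventually_affine_ne (h : IsBracket br) (a : ℂ) {s : ℂ} (hs : s ≠ 0) :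
    ∀ᶠ t in Filter.cocountable, br (a + s * t) ≠ 0 := by
  rw [Filter.Eventually, Filter.mem_cocountable]
  refine (h.countable_setOf_eq_zero.preimage_of_injOn (f := fun t => a + s * t) ?_).mono
    fun t ht => by simpa using ht
  intro t _ u _ htu
  exact mul_left_cancel₀ hs (add_left_cancel htu)

/-- Translation of the `i`-th coordinate by the purely imaginary multiple `(i + 1) * I` of `t`. -/
noncomputable def perturb (v : Fin m → ℂ) (t : ℂ) : Fin m → ℂ :=
  fun i => v i + ((i : ℕ) + 1 : ℂ) * Complex.I * t

theorem perturb_zero (v : Fin m → ℂ) : perturb v 0 = v := by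
  funext i
  simp [perturb]

theorem continuous_perturb (v : Fin m → ℂ) (i : Fin m) : Continuous fun t => perturb v t i := by
  unfold perturb
  fun_prop

theorem intCast_mul_I_add_intCast_ne_zero {a : ℤ} (ha : a ≠ 0) (b : ℤ) :
    (a : ℂ) * Complex.I + b ≠ 0 := fun h0 => ha <| by
  have := congrArg Complex.im h0
  simpa using this

theorem IsBracket.eventually_latticeNe (h : IsBracket br) {Y : ℂ → ℂ} {a : ℤ} (ha : a ≠ 0)
    (X : ℂ) (hY : ∀ t, Y t = X + a * Complex.I * t) :
    ∀ᶠ t in Filter.cocountable, LatticeNe br δ (κ + t) (Y t) := by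
  simp only [LatticeNe, eventually_countable_forall]
  intro p q
  filter_upwards [h.eventually_affine_ne (X + p * δ + q * κ)
    (intCast_mul_I_add_intCast_ne_zero ha q)] with t ht
  convert ht using 2
  rw [hY]
  ring

theorem IsBracket.eventually_perturb_sub (h : IsBracket br) (v : Fin m → ℂ) :
    ∀ᶠ t in Filter.cocountable, ∀ i j, i ≠ j →
      LatticeNe br δ (κ + t) (perturb v t i - perturb v t j) := by
  simp only [eventually_countable_forall]
  intro i j hij
  refine h.eventually_latticeNe (a := (i : ℕ) - (j : ℕ)) (fun h0 => hij (Fin.ext (by omega)))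
    (v i - v j) fun t => ?_
  simp only [perturb]
  push_cast
  ring

theorem IsBracket.eventually_perturb_add (h : IsBracket br) (v w : Fin m → ℂ) :
    ∀ᶠ t in Filter.cocountable, ∀ i j,
      LatticeNe br δ (κ + t) (perturb v t i + perturb w t j) := by
  simp only [eventually_countable_forall]
  intro i j
  refine h.eventually_latticeNe (a := (i : ℕ) + (j : ℕ) + 2) (by omega) (v i + w j) fun t => ?_
  simp only [perturb]
  push_cast
  ring

/-- The transformation holds at all but countably many points of a line through the given
parameters. -/
theorem IsBracket.eventually_sum_LSWterm_comm (h : IsBracket br)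
    (hδ : ∀ n : ℕ, 1 ≤ n → br ((n : ℂ) * δ) ≠ 0) (k : ℕ) (x z : Fin m → ℂ) :
    ∀ᶠ t in Filter.cocountable,
      ∑ μ ∈ muSet m k, LSWterm br δ (κ + t) μ (perturb x t) (perturb z t)
        = ∑ μ ∈ muSet m k, LSWterm br δ (κ + t) μ (perturb z t) (perturb x t) := by
  have hκ : ∀ᶠ t in Filter.cocountable, ∀ n : ℤ, br (n * δ + (κ + t)) ≠ 0 := by
    rw [eventually_countable_forall]
    intro n
    filter_upwards [h.eventually_affine_ne (n * δ + κ) one_ne_zero] with t ht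
    rwa [one_mul, add_assoc] at ht
  filter_upwards [hκ, h.eventually_perturb_sub x, h.eventually_perturb_sub z,
    h.eventually_perturb_add x z] with t h0 hx hz hxz
  simp only [LSWterm_eq]
  exact sum_hcoef_kernelRatio_comm h hδ h0 k _ _ hx hz hxz

theorem continuous_sfac_natCast (hbr : Continuous br) {X : ℂ → ℂ} (hX : Continuous X) (n : ℕ) :
    Continuous fun t => sfac br δ (X t) n := by
  simp only [sfac_natCast]
  fun_prop

theorem continuousAt_sfac_div (hbr : Continuous br) {X Y : ℂ → ℂ} (hX : Continuous X)
    (hY : Continuous Y) (t₀ : ℂ) (n : ℤ)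
    (h0 : if 0 ≤ n then sfac br δ (Y t₀) n ≠ 0 else sfac br δ (X t₀) n ≠ 0) :
    ContinuousAt (fun t => sfac br δ (X t) n / sfac br δ (Y t) n) t₀ := by
  split_ifs at h0 with hn
  · lift n to ℕ using hn
    exact (continuous_sfac_natCast hbr hX n).continuousAt.div
      (continuous_sfac_natCast hbr hY n).continuousAt h0
  · simp only [sfac, if_neg hn, div_inv_eq_mul, ne_eq, inv_eq_zero] at h0 ⊢
    refine ContinuousAt.mul (ContinuousAt.inv₀ ?_ h0) ?_
    · exact Continuous.continuousAt (by fun_prop)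
    · exact Continuous.continuousAt (by fun_prop)

theorem continuousAt_LSWterm (hbr : Continuous br) (μ : Fin m → ℕ) (x z : Fin m → ℂ)
    (h0 : LSWDenomNZ br δ κ μ x z) :
    ContinuousAt (fun t => LSWterm br δ (κ + t) μ (perturb x t) (perturb z t)) 0 := by
  have hx := continuous_perturb x
  have hz := continuous_perturb z
  unfold LSWterm
  refine tendsto_finsetProd _ fun i _ => tendsto_finsetProd _ fun j _ => ?_
  obtain ⟨h1, h2, h3⟩ := h0 i j
  have hxδ : Continuous fun t => perturb x t i - perturb x t j + δ :=
    ((hx i).sub (hx j)).add continuous_const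
  have hxκ : Continuous fun t => perturb x t i - perturb x t j + (κ + t) :=
    ((hx i).sub (hx j)).add (continuous_const.add continuous_id)
  have hxz : Continuous fun t => perturb x t i + perturb z t j := (hx i).add (hz j)
  have hxzκ : Continuous fun t => perturb x t i + perturb z t j + δ - (κ + t) :=
    (hxz.add continuous_const).sub (continuous_const.add continuous_id)
  refine ContinuousAt.mul (continuousAt_sfac_div hbr hxδ hxκ 0 _ ?_) (ContinuousAt.div ?_ ?_ ?_)
  · simpa only [perturb_zero, add_zero] using h1
  · exact ((continuous_sfac_natCast hbr hxκ _).mul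
      (continuous_sfac_natCast hbr hxz _)).continuousAt
  · exact ((continuous_sfac_natCast hbr hxδ _).mul
      (continuous_sfac_natCast hbr hxzκ _)).continuousAt
  · simpa only [perturb_zero, add_zero] using mul_ne_zero h2 h3

end perturbation

/-- Elliptic hypergeometric transformation
(Langer–Schlosser–Warnaar identity): the sum is symmetric under `x ↔ z`,
at every admissible point. -/
theorem LSW_transformation
    (br : ℂ → ℂ) (hodd : ∀ z : ℂ, br (-z) = -br z)
    (hent : Differentiable ℂ br) (hnz : br ≠ 0)
    (hW : ∀ a b c d : ℂ,
      br (a + b) * br (a - b) * br (c + d) * br (c - d)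
        + br (a + d) * br (a - d) * br (b + c) * br (b - c)
        = br (a + c) * br (a - c) * br (b + d) * br (b - d))
    (δ κ : ℂ)
    (hδ : ∀ n : ℕ, 1 ≤ n → br ((n : ℂ) * δ) ≠ 0)
    (hκ : ∀ n : ℕ, 1 ≤ n → br ((n : ℂ) * κ) ≠ 0)
    (m k : ℕ) (x z : Fin m → ℂ)
    (h1 : ∀ μ ∈ muSet m k, LSWDenomNZ br δ κ μ x z)
    (h2 : ∀ μ ∈ muSet m k, LSWDenomNZ br δ κ μ z x) :
    ∑ μ ∈ muSet m k, LSWterm br δ κ μ x z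
      = ∑ μ ∈ muSet m k, LSWterm br δ κ μ z x := by
  have h : IsBracket br := ⟨hodd, hent, hnz, hW⟩
  have hdense := (Filter.mem_cocountable.mp
    (h.eventually_sum_LSWterm_comm (κ := κ) hδ k x z)).dense_compl ℂ
  rw [compl_compl] at hdense
  have : (nhdsWithin (0 : ℂ) _).NeBot := mem_closure_iff_nhdsWithin_neBot.mp (hdense 0)
  have hF : ContinuousAt
      (fun t => ∑ μ ∈ muSet m k, LSWterm br δ (κ + t) μ (perturb x t) (perturb z t)) 0 :=
    tendsto_finsetSum _ fun μ hμ => continuousAt_LSWterm h.continuous μ x z (h1 μ hμ)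
  have hG : ContinuousAt
      (fun t => ∑ μ ∈ muSet m k, LSWterm br δ (κ + t) μ (perturb z t) (perturb x t)) 0 :=
    tendsto_finsetSum _ fun μ hμ => continuousAt_LSWterm h.continuous μ z x (h2 μ hμ)
  have heq := tendsto_nhds_unique_of_eventuallyEq (hF.tendsto.mono_left nhdsWithin_le_nhds)
    (hG.tendsto.mono_left nhdsWithin_le_nhds) (self_mem_nhdsWithin)
  simpa only [perturb_zero, add_zero] using heq
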